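/- arXiv:2312.14294 — 2 statements merged into one kernel-verified Lean document; each statement's English description precedes it below -/
import Mathlib

section
/- Let n ≥ 2 be a natural number, let t ≥ 1 be a real number, and let α ≥ α' > 0 be real numbers with α − α' ≤ 1 / log n. Then n^{−α/(2α+t)} ≤ n^{−α'/(2α'+t)} ≤ 3 · n^{−α/(2α+t)}. -/
/-- The exponent `a / (2a + t)` of the nonparametric rate is nondecreasing in `a`. -/
theorem rateExponent_mono {t a b : ℝ} (ht : 0 < t) (ha : 0 < a) (hab : a ≤ b) :
    a / (2 * a + t) ≤ b / (2 * b + t) := by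
  have hb : 0 < b := by linarith
  rw [div_le_div_iff₀ (by positivity) (by positivity)]
  nlinarith

/-- For `1 ≤ t` the exponent `a / (2a + t)` of the nonparametric rate is 1-Lipschitz in `a`. -/
theorem rateExponent_sub_le {t a b : ℝ} (ht : 1 ≤ t) (ha : 0 < a) (hab : a ≤ b) :
    b / (2 * b + t) - a / (2 * a + t) ≤ b - a := by
  have hb : 0 < b := by linarith
  have ht0 : 0 < t := by linarith
  have hprod : t ≤ (2 * b + t) * (2 * a + t) := by
    nlinarith [mul_pos ha hb, mul_pos ha ht0, mul_pos hb ht0]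
  rw [div_sub_div _ _ (by positivity) (by positivity), div_le_iff₀ (by positivity)]
  nlinarith [mul_le_mul_of_nonneg_left hprod (sub_nonneg.2 hab)]

/-- For smoothnesses `α'` in the interval `[α - 1/log n, α]`, the nonparametric rate
`ε_n^{α',t} = n^{-α'/(2α'+t)}` is equivalent to `ε_n^{α,t}` up to the universal factor 3:
`n^{-α/(2α+t)} ≤ n^{-α'/(2α'+t)} ≤ 3 n^{-α/(2α+t)}`. -/
theorem rate_equivalence_nearby_smoothness (n : ℕ) (hn : 2 ≤ n) (t : ℝ) (ht : 1 ≤ t)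
    (α α' : ℝ) (hα' : 0 < α') (hαα' : α' ≤ α) (hclose : α - α' ≤ 1 / Real.log n) :
    (n : ℝ) ^ (-(α / (2 * α + t))) ≤ (n : ℝ) ^ (-(α' / (2 * α' + t))) ∧
      (n : ℝ) ^ (-(α' / (2 * α' + t))) ≤ 3 * (n : ℝ) ^ (-(α / (2 * α + t))) := by
  have hn1 : (1 : ℝ) < n := by exact_mod_cast hn
  have hn0 : (0 : ℝ) < n := by linarith
  have ht0 : 0 < t := by linarith
  have hα : 0 < α := by linarith
  have hlog : Real.log n ≠ 0 := (Real.log_pos hn1).ne'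
  refine ⟨Real.rpow_le_rpow_of_exponent_le hn1.le
    (neg_le_neg (rateExponent_mono ht0 hα' hαα')), ?_⟩
  have hexp : -(α' / (2 * α' + t)) ≤ 1 / Real.log n + -(α / (2 * α + t)) := by
    linarith [rateExponent_sub_le ht hα' hαα']
  calc (n : ℝ) ^ (-(α' / (2 * α' + t)))
      ≤ (n : ℝ) ^ (1 / Real.log n + -(α / (2 * α + t))) :=
        Real.rpow_le_rpow_of_exponent_le hn1.le hexp
    _ = Real.exp 1 * (n : ℝ) ^ (-(α / (2 * α + t))) := by
        rw [Real.rpow_add hn0, Real.rpow_def_of_pos hn0 (1 / Real.log n), mul_one_div_cancel hlog]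
    _ ≤ 3 * (n : ℝ) ^ (-(α / (2 * α + t))) := by
        gcongr
        exact Real.exp_one_lt_three.le
end

section
/- Let (X, 𝒜, μ) be a probability space, (Θ, ℬ) a measurable space, and G : Θ × X → ℝ a bounded jointly measurable function. For θ ∈ Θ define the probability density p_θ(y,x) = (2π)^{−1/2} exp(−(y − G(θ,x))²/2) with respect to Lebesgue measure times μ on ℝ × X, let P_θ be the corresponding probability measure on ℝ × X, and let P_θ^n be its n-fold product on (ℝ × X)^n. Fix θ* ∈ Θ and a probability measure Π on Θ (the prior). For data D = ((y₁,x₁),…,(y_n,x_n)) and measurable A ⊆ Θ define the posterior Π(A | D) = [ ∫_A ∏_{i=1}^n p_θ(y_i,x_i) dΠ(θ) ] / [ ∫_Θ ∏_{i=1}^n p_θ(y_i,x_i) dΠ(θ) ]. For a > 0 define the Kullback–Leibler neighbourhood 𝓑₂(a) = { θ ∈ Θ : ∫∫ p_{θ*} log(p_{θ*}/p_θ) dy dμ ≤ a² and ∫∫ p_{θ*} (log(p_{θ*}/p_θ))² dy dμ ≤ a² }. Suppose (a_n) is a positive sequence with n·a_n² → ∞, Π(𝓑₂(a_n)) > 0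 for all n, and (A_n) is a sequence of measurable subsets of Θ such that e^{2 n a_n²} · Π(A_n) / Π(𝓑₂(a_n)) → 0 as n → ∞. Then ∫_{(ℝ×X)^n} Π(A_n | D) dP_{θ*}^n(D) → 0 as n → ∞. -/
open MeasureTheory Filter

/-- The Gaussian regression density on `ℝ × X` with regression function `g`:
`p(y,x) = (2π)^{-1/2} exp(-(y - g(x))²/2)`. -/
noncomputable def regDensity {X : Type*} (g : X → ℝ) (z : ℝ × X) : ℝ :=
  (Real.sqrt (2 * Real.pi))⁻¹ * Real.exp (-(z.1 - g z.2) ^ 2 / 2)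

theorem lintegral_pi_prod_eq_prod {E : Type*} [MeasurableSpace E] (ν : Measure E) [SigmaFinite ν]
    {n : ℕ} (f : Fin n → E → ENNReal) (hf : ∀ i, Measurable (f i)) :
    ∫⁻ D, ∏ i, f i (D i) ∂(Measure.pi fun _ : Fin n => ν) = ∏ i, ∫⁻ z, f i z ∂ν := by
  induction n with
  | zero => simp
  | succ n ih =>
    have e := (measurePreserving_piFinSuccAbove (fun _ : Fin (n + 1) => ν) 0).symm
    rw [← e.lintegral_comp (by fun_prop)]
    simp_rw [MeasurableEquiv.piFinSuccAbove_symm_apply, Fin.insertNthEquiv,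
      Fin.prod_univ_succ, Fin.insertNth_zero, Equiv.coe_fn_mk, Fin.cons_succ, Fin.cons_zero]
    rw [← ih (fun i => f i.succ) (fun i => hf _)]
    exact lintegral_prod_mul (hf 0).aemeasurable (Finset.measurable_fun_prod _ fun (i : Fin n) _ =>
      (hf i.succ).comp (measurable_pi_apply i)).aemeasurable

theorem pi_withDensity_eq {E : Type*} [MeasurableSpace E] (ν : Measure E) [SigmaFinite ν]
    (n : ℕ) (f : E → ENNReal) (hf : Measurable f) [SigmaFinite (ν.withDensity f)] :
    (Measure.pi fun _ : Fin n => ν.withDensity f) =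
      (Measure.pi fun _ : Fin n => ν).withDensity fun D => ∏ i, f (D i) := by
  refine Measure.pi_eq fun s hs => ?_
  rw [withDensity_apply _ (MeasurableSet.univ_pi hs),
    ← lintegral_indicator (MeasurableSet.univ_pi hs)]
  have h : ∀ D : Fin n → E, (Set.univ.pi s).indicator (fun D => ∏ i, f (D i)) D
      = ∏ i, (s i).indicator f (D i) := by
    intro D
    by_cases hD : D ∈ Set.univ.pi s
    · rw [Set.indicator_of_mem hD]
      exact Finset.prod_congr rfl fun i _ => (Set.indicator_of_mem (hD i trivial) _).symm
    · rw [Set.indicator_of_notMem hD]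
      obtain ⟨i, hi⟩ : ∃ i, D i ∉ s i := by simpa [Set.mem_pi] using hD
      exact (Finset.prod_eq_zero (Finset.mem_univ i) (Set.indicator_of_notMem hi _)).symm
  simp_rw [h]
  rw [lintegral_pi_prod_eq_prod ν _ fun i => hf.indicator (hs i)]
  refine Finset.prod_congr rfl fun i _ => ?_
  rw [lintegral_indicator (hs i), withDensity_apply _ (hs i)]

/-- Chebyshev's inequality for an i.i.d. sum whose first two moments are at most `s`. -/
theorem pi_sum_gt_le_of_moments {E : Type*} [MeasurableSpace E] (P : Measure E)
    [IsProbabilityMeasure P] (f : E → ℝ) (hf : MemLp f 2 P) {s : ℝ} (hs : 0 < s)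
    (h1 : ∫ z, f z ∂P ≤ s) (h2 : ∫ z, f z ^ 2 ∂P ≤ s) {n : ℕ} (hn : 0 < n) :
    (Measure.pi fun _ : Fin n => P) {D | 2 * n * s < ∑ i, f (D i)} ≤
      ENNReal.ofReal (1 / (n * s)) := by
  have hn' : (0 : ℝ) < n := by exact_mod_cast hn
  have hcoord : ∀ i : Fin n,
      MemLp (fun D : Fin n → E => f (D i)) 2 (Measure.pi fun _ : Fin n => P) := fun i =>
    hf.comp_measurePreserving (measurePreserving_eval _ i)
  have hmem : MemLp (∑ i, fun D : Fin n → E => f (D i)) 2 (Measure.pi fun _ : Fin n => P) :=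
    memLp_finsetSum' _ fun i _ => hcoord i
  have hvar : ProbabilityTheory.variance (∑ i, fun D : Fin n → E => f (D i))
      (Measure.pi fun _ : Fin n => P) ≤ n * s := by
    rw [ProbabilityTheory.variance_sum_pi (X := fun _ => f) (fun _ => hf)]
    have := (ProbabilityTheory.variance_le_expectation_sq hf.1).trans h2
    simpa using mul_le_mul_of_nonneg_left this hn'.le
  have hmean : ∫ D, (∑ i, fun D : Fin n → E => f (D i)) D ∂(Measure.pi fun _ : Fin n => P)
      ≤ n * s := by
    simp_rw [Finset.sum_apply]
    rw [integral_finsetSum _ fun i _ => (hcoord i).integrable one_le_two]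
    simp_rw [integral_comp_eval (μ := fun _ : Fin n => P) hf.1]
    simpa using mul_le_mul_of_nonneg_left h1 hn'.le
  have hns : 0 < n * s := mul_pos hn' hs
  refine (measure_mono fun D hD => ?_).trans
    ((ProbabilityTheory.meas_ge_le_variance_div_sq hmem hns).trans (ENNReal.ofReal_le_ofReal ?_))
  · have hD' : 2 * n * s < ∑ i, f (D i) := hD
    change (n * s : ℝ) ≤ |_|
    refine le_trans ?_ (le_abs_self _)
    rw [Finset.sum_apply]
    linarith
  · rw [div_le_div_iff₀ (by positivity) hns]
    nlinarith

/-- Lower bound on the evidence: if each likelihood with parameter in `K` is at least `c * M` outside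
a set of probability `δ`, then the evidence is at least `c * (prior K / 2) * M` outside a set of
probability `2 * δ`. -/
theorem measure_evidence_lt_le {Θ Ω : Type*} [MeasurableSpace Θ] [MeasurableSpace Ω]
    (prior : Measure Θ) [IsProbabilityMeasure prior] (Q : Measure Ω) [SFinite Q]
    (L : Θ → Ω → ENNReal) (hL : Measurable fun p : Θ × Ω => L p.1 p.2)
    (M : Ω → ENNReal) (hM : Measurable M) (c δ : ENNReal)
    (K : Set Θ) (hK : MeasurableSet K) (hK0 : prior K ≠ 0)
    (hδ : ∀ θ ∈ K, Q {ω | L θ ω < c * M ω} ≤ δ) :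
    Q {ω | ∫⁻ θ, L θ ω ∂prior < c * (prior K / 2) * M ω} ≤ 2 * δ := by
  set S : Set (Θ × Ω) := {p | L p.1 p.2 < c * M p.2}
  have hS : MeasurableSet S := measurableSet_lt hL (by fun_prop)
  have hKt : prior K ≠ ⊤ := measure_ne_top _ _
  have hK2 : prior K / 2 ≠ 0 := (ENNReal.half_pos hK0).ne'
  have hK2t : prior K / 2 ≠ ⊤ := ENNReal.div_ne_top hKt (by simp)
  have hT : MeasurableSet (S ∩ K ×ˢ Set.univ) := hS.inter (hK.prod MeasurableSet.univ)
  set T := S ∩ K ×ˢ (Set.univ : Set Ω)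
  have hsub : {ω | ∫⁻ θ, L θ ω ∂prior < c * (prior K / 2) * M ω} ⊆
      {ω | prior K / 2 ≤ prior ((fun θ => (θ, ω)) ⁻¹' T)} := by
    intro ω hω
    by_contra hlt
    simp only [Set.mem_ofPred_eq, not_le] at hlt hω
    refine absurd hω (not_lt.mpr ?_)
    set U := (fun θ => (θ, ω)) ⁻¹' T
    have hU : MeasurableSet U := hT.preimage (by fun_prop)
    have h1 : prior K / 2 ≤ prior (K \ U) := by
      have := le_measure_sdiff (μ := prior) (s₁ := K) (s₂ := U)
      refine le_trans ?_ this
      calc prior K / 2 = prior K - prior K / 2 := (ENNReal.sub_half hKt).symm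
        _ ≤ _ := tsub_le_tsub_left hlt.le _
    calc c * (prior K / 2) * M ω = c * M ω * (prior K / 2) := by ring
      _ ≤ c * M ω * prior (K \ U) := by gcongr
      _ = ∫⁻ _ in K \ U, c * M ω ∂prior := by simp
      _ ≤ ∫⁻ θ in K \ U, L θ ω ∂prior := by
        refine setLIntegral_mono' (hK.diff hU) fun θ hθ => ?_
        by_contra hcon
        exact hθ.2 ⟨not_le.mp hcon, hθ.1, trivial⟩
      _ ≤ ∫⁻ θ, L θ ω ∂prior := setLIntegral_le_lintegral _ _
  have hmarkov := mul_meas_ge_le_lintegral (μ := Q)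
    (measurable_measure_prodMk_right (μ := prior) hT) (prior K / 2)
  have hswap : ∫⁻ ω, prior ((fun θ => (θ, ω)) ⁻¹' T) ∂Q ≤ prior K * δ := by
    rw [← Measure.prod_apply_symm hT, Measure.prod_apply hT]
    calc ∫⁻ θ, Q (Prod.mk θ ⁻¹' T) ∂prior ≤ ∫⁻ θ, K.indicator (fun _ => δ) θ ∂prior := by
          refine lintegral_mono fun θ => ?_
          by_cases hθ : θ ∈ K
          · rw [Set.indicator_of_mem hθ]
            exact (measure_mono fun ω hω => hω.1).trans (hδ θ hθ)
          · have : Prod.mk θ ⁻¹' T = ∅ := by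
              ext ω; simp [T, hθ]
            simp [this]
      _ = prior K * δ := by rw [lintegral_indicator hK]; simp [mul_comm]
  have hfin : prior K / 2 * Q {ω | ∫⁻ θ, L θ ω ∂prior < c * (prior K / 2) * M ω} ≤
      prior K / 2 * (2 * δ) := by
    calc _ ≤ _ := by gcongr
      _ ≤ _ := hmarkov
      _ ≤ _ := hswap
      _ = _ := by rw [← mul_assoc, ENNReal.div_mul_cancel two_ne_zero (by simp)]
  exact (ENNReal.mul_le_mul_iff_right hK2 hK2t).mp hfin

/-- Splitting according to whether the evidence is at least `κ` times the true likelihood. -/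
theorem lintegral_posterior_mul_le {Θ Ω : Type*} [MeasurableSpace Θ] [MeasurableSpace Ω]
    (prior : Measure Θ) [IsProbabilityMeasure prior] (N : Measure Ω) [SFinite N]
    (L : Θ → Ω → ENNReal) (hL : Measurable fun p : Θ × Ω => L p.1 p.2)
    (hL1 : ∀ θ, ∫⁻ ω, L θ ω ∂N = 1) (M : Ω → ENNReal) (hM : Measurable M)
    (A : Set Θ) (κ : ENNReal) (hκ : κ ≠ 0) (hκt : κ ≠ ⊤) :
    ∫⁻ ω, (∫⁻ θ in A, L θ ω ∂prior) / (∫⁻ θ, L θ ω ∂prior) * M ω ∂N ≤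
      N.withDensity M {ω | ∫⁻ θ, L θ ω ∂prior < κ * M ω} + prior A / κ := by
  have hZ : Measurable fun ω => ∫⁻ θ, L θ ω ∂prior := hL.lintegral_prod_left'
  have hZA : Measurable fun ω => ∫⁻ θ in A, L θ ω ∂prior := hL.lintegral_prod_left'
  have hbad : MeasurableSet {ω | ∫⁻ θ, L θ ω ∂prior < κ * M ω} :=
    measurableSet_lt hZ (by fun_prop)
  have hpt : ∀ ω, (∫⁻ θ in A, L θ ω ∂prior) / (∫⁻ θ, L θ ω ∂prior) * M ω ≤
      {ω | ∫⁻ θ, L θ ω ∂prior < κ * M ω}.indicator M ω +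
        (∫⁻ θ in A, L θ ω ∂prior) * κ⁻¹ := by
    intro ω
    by_cases hω : ω ∈ {ω | ∫⁻ θ, L θ ω ∂prior < κ * M ω}
    · rw [Set.indicator_of_mem hω]
      refine le_trans ?_ le_self_add
      refine mul_le_of_le_one_left' (ENNReal.div_le_of_le_mul ?_)
      rw [one_mul]
      exact setLIntegral_le_lintegral _ _
    · rw [Set.indicator_of_notMem hω, zero_add, div_eq_mul_inv, mul_assoc]
      gcongr
      have hle : κ * M ω ≤ ∫⁻ θ, L θ ω ∂prior := not_lt.mp hω
      rw [mul_comm, ← div_eq_mul_inv]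
      refine ENNReal.div_le_of_le_mul ?_
      calc M ω = κ⁻¹ * (κ * M ω) := by
            rw [← mul_assoc, ENNReal.inv_mul_cancel hκ hκt, one_mul]
        _ ≤ _ := by gcongr
  refine (lintegral_mono hpt).trans ?_
  rw [lintegral_add_left (hM.indicator hbad), lintegral_indicator hbad,
    withDensity_apply _ hbad, lintegral_mul_const _ hZA, lintegral_lintegral_swap]
  · simp [hL1, div_eq_mul_inv]
  · exact (hL.comp measurable_swap).aemeasurable

theorem regDensity_eq_gaussianPDFReal {X : Type*} (g : X → ℝ) (y : ℝ) (x : X) :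
    regDensity g (y, x) = ProbabilityTheory.gaussianPDFReal (g x) 1 y := by
  simp [regDensity, ProbabilityTheory.gaussianPDFReal]

theorem regDensity_pos {X : Type*} (g : X → ℝ) (z : ℝ × X) : 0 < regDensity g z := by
  unfold regDensity
  positivity

theorem regDensity_le {X : Type*} (g : X → ℝ) (z : ℝ × X) :
    regDensity g z ≤ (Real.sqrt (2 * Real.pi))⁻¹ := by
  refine mul_le_of_le_one_right (by positivity) (Real.exp_le_one_iff.mpr ?_)
  nlinarith [sq_nonneg (z.1 - g z.2)]

theorem measurable_regDensity_comp {X Θ α : Type*} [MeasurableSpace X] [MeasurableSpace Θ]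
    [MeasurableSpace α] {G : Θ → X → ℝ} (hG : Measurable fun p : Θ × X => G p.1 p.2)
    {u : α → Θ} {v : α → ℝ × X} (hu : Measurable u) (hv : Measurable v) :
    Measurable fun a => regDensity (G (u a)) (v a) := by
  have : Measurable fun a => G (u a) (v a).2 :=
    hG.comp (hu.prodMk (measurable_snd.comp hv))
  unfold regDensity
  fun_prop

theorem measurable_regDensity {X : Type*} [MeasurableSpace X] {g : X → ℝ} (hg : Measurable g) :
    Measurable (regDensity g) := by
  unfold regDensity
  fun_prop

theorem lintegral_regDensity_eq_one {X : Type*} [MeasurableSpace X] (μ : Measure X)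
    [IsProbabilityMeasure μ] {g : X → ℝ} (hg : Measurable g) :
    ∫⁻ z, ENNReal.ofReal (regDensity g z) ∂((volume : Measure ℝ).prod μ) = 1 := by
  rw [lintegral_prod_symm' _ (measurable_regDensity hg).ennreal_ofReal]
  simp_rw [regDensity_eq_gaussianPDFReal,
    ProbabilityTheory.lintegral_gaussianPDFReal_eq_one _ one_ne_zero]
  simp

theorem log_regDensity_div {X : Type*} (g h : X → ℝ) (z : ℝ × X) :
    Real.log (regDensity g z / regDensity h z) =
      ((z.1 - h z.2) ^ 2 - (z.1 - g z.2) ^ 2) / 2 := by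
  have hc : (Real.sqrt (2 * Real.pi))⁻¹ ≠ 0 := by positivity
  unfold regDensity
  rw [mul_div_mul_left _ _ hc, ← Real.exp_sub, Real.log_exp]
  ring

theorem memLp_two_log_regDensity_div {X : Type*} [MeasurableSpace X] (μ : Measure X)
    [IsProbabilityMeasure μ] {g h : X → ℝ} (hg : Measurable g) (hh : Measurable h) {B : ℝ}
    (hgB : ∀ x, |g x| ≤ B) (hhB : ∀ x, |h x| ≤ B) :
    MemLp (fun z => Real.log (regDensity g z / regDensity h z)) 2
      (((volume : Measure ℝ).prod μ).withDensity fun z => ENNReal.ofReal (regDensity g z)) := by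
  have hp := measurable_regDensity hg
  have hq := measurable_regDensity hh
  have hf : Measurable fun z => Real.log (regDensity g z / regDensity h z) :=
    Real.measurable_log.comp (hp.div hq)
  rw [memLp_two_iff_integrable_sq hf.aestronglyMeasurable,
    integrable_withDensity_iff hp.ennreal_ofReal (ae_of_all _ fun _ => ENNReal.ofReal_lt_top)]
  have hdom : Integrable (fun y : ℝ => (8 * B ^ 2 * y ^ 2 + 2 * B ^ 4) *
      ((Real.sqrt (2 * Real.pi))⁻¹ * (Real.exp (B ^ 2 / 2) * Real.exp (-(1 / 4) * y ^ 2)))) := by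
    have i0 := integrable_exp_neg_mul_sq (b := 1 / 4) (by norm_num)
    have i2 := integrable_rpow_mul_exp_neg_mul_sq (b := 1 / 4) (by norm_num) (s := 2) (by norm_num)
    simp_rw [Real.rpow_two] at i2
    refine ((i2.const_mul (8 * B ^ 2 * (Real.sqrt (2 * Real.pi))⁻¹ * Real.exp (B ^ 2 / 2))).add
      (i0.const_mul (2 * B ^ 4 * (Real.sqrt (2 * Real.pi))⁻¹ * Real.exp (B ^ 2 / 2)))).congr
      (ae_of_all _ fun y => ?_)
    simp only [Pi.add_apply]
    ring
  refine (hdom.comp_fst μ).mono ((hf.pow_const 2).mul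
    hp.ennreal_ofReal.ennreal_toReal).aestronglyMeasurable (ae_of_all _ fun z => ?_)
  rw [ENNReal.toReal_ofReal (regDensity_pos g z).le, Real.norm_of_nonneg
    (mul_nonneg (sq_nonneg _) (regDensity_pos g z).le)]
  refine le_trans ?_ (le_abs_self _)
  obtain ⟨g1, g2⟩ := abs_le.mp (hgB z.2)
  obtain ⟨h1, h2⟩ := abs_le.mp (hhB z.2)
  have hgsq : g z.2 ^ 2 ≤ B ^ 2 := by nlinarith
  have hhsq : h z.2 ^ 2 ≤ B ^ 2 := by nlinarith
  refine mul_le_mul ?_ ?_ (regDensity_pos g z).le (by positivity)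
  · have hd : (g z.2 - h z.2) ^ 2 ≤ 4 * B ^ 2 := by nlinarith [sq_nonneg (g z.2 + h z.2)]
    have he : ((h z.2 ^ 2 - g z.2 ^ 2) / 2) ^ 2 ≤ B ^ 4 := by
      have : |(h z.2 ^ 2 - g z.2 ^ 2) / 2| ≤ B ^ 2 := by
        rw [abs_le]
        constructor <;> nlinarith [sq_nonneg (g z.2), sq_nonneg (h z.2)]
      calc _ ≤ (B ^ 2) ^ 2 := sq_le_sq' (abs_le.mp this).1 (abs_le.mp this).2
        _ = B ^ 4 := by ring
    have hy : (z.1 * (g z.2 - h z.2)) ^ 2 ≤ 4 * B ^ 2 * z.1 ^ 2 := by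
      rw [mul_pow, mul_comm]
      gcongr
    rw [log_regDensity_div, show ((z.1 - h z.2) ^ 2 - (z.1 - g z.2) ^ 2) / 2 =
      z.1 * (g z.2 - h z.2) + (h z.2 ^ 2 - g z.2 ^ 2) / 2 by ring]
    nlinarith [sq_nonneg (z.1 * (g z.2 - h z.2) - (h z.2 ^ 2 - g z.2 ^ 2) / 2)]
  · unfold regDensity
    rw [← Real.exp_add]
    gcongr
    nlinarith [sq_nonneg (z.1 / 2 - g z.2)]

theorem integral_withDensity_regDensity {X : Type*} [MeasurableSpace X] (μ : Measure X)
    [IsProbabilityMeasure μ] {g : X → ℝ} (hg : Measurable g) {F : ℝ × X → ℝ}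
    (hF : Integrable F
      (((volume : Measure ℝ).prod μ).withDensity fun z => ENNReal.ofReal (regDensity g z))) :
    ∫ z, F z ∂(((volume : Measure ℝ).prod μ).withDensity
        fun z => ENNReal.ofReal (regDensity g z)) =
      ∫ x, (∫ y, regDensity g (y, x) * F (y, x)) ∂μ := by
  have hp := (measurable_regDensity hg).ennreal_ofReal
  have hlt : ∀ᵐ z ∂((volume : Measure ℝ).prod μ), ENNReal.ofReal (regDensity g z) < ⊤ :=
    ae_of_all _ fun _ => ENNReal.ofReal_lt_top
  have htr : ∀ z, (ENNReal.ofReal (regDensity g z)).toReal = regDensity g z := fun z =>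
    ENNReal.toReal_ofReal (regDensity_pos g z).le
  rw [integrable_withDensity_iff_integrable_smul' hp hlt] at hF
  rw [integral_withDensity_eq_integral_toReal_smul hp hlt]
  simp_rw [htr, smul_eq_mul] at hF ⊢
  exact integral_prod_symm _ hF

theorem measurable_integral_regDensity_mul {X Θ : Type*} [MeasurableSpace X] [MeasurableSpace Θ]
    (μ : Measure X) [IsProbabilityMeasure μ] {g : X → ℝ} (hg : Measurable g)
    {F : Θ → ℝ × X → ℝ} (hF : Measurable fun p : Θ × (ℝ × X) => F p.1 p.2) :
    Measurable fun θ => ∫ x, (∫ y, regDensity g (y, x) * F θ (y, x)) ∂μ := by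
  have hp := measurable_regDensity hg
  have h : Measurable fun q : (Θ × X) × ℝ =>
      regDensity g (q.2, q.1.2) * F q.1.1 (q.2, q.1.2) := by
    have hre : Measurable fun q : (Θ × X) × ℝ => (q.1.1, (q.2, q.1.2)) := by fun_prop
    exact (hp.comp (measurable_snd.comp hre)).mul (hF.comp hre)
  exact h.stronglyMeasurable.integral_prod_right'.integral_prod_right'.measurable

theorem lt_sum_log_of_ofReal_prod_lt {ι E : Type*} [Fintype ι] {p q : E → ℝ}
    (hp : ∀ z, 0 < p z) (hq : ∀ z, 0 < q z) {t : ℝ} {D : ι → E}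
    (h : ∏ i, ENNReal.ofReal (q (D i)) <
      ENNReal.ofReal (Real.exp (-t)) * ∏ i, ENNReal.ofReal (p (D i))) :
    t < ∑ i, Real.log (p (D i) / q (D i)) := by
  have hP : 0 < ∏ i, p (D i) := Finset.prod_pos fun i _ => hp _
  have hQ : 0 < ∏ i, q (D i) := Finset.prod_pos fun i _ => hq _
  rw [← ENNReal.ofReal_prod_of_nonneg fun i _ => (hq _).le,
    ← ENNReal.ofReal_prod_of_nonneg fun i _ => (hp _).le,
    ← ENNReal.ofReal_mul (Real.exp_pos _).le, ENNReal.ofReal_lt_ofReal_iff (by positivity)] at h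
  rw [← Real.log_prod fun i _ => (div_pos (hp _) (hq _)).ne', Finset.prod_div_distrib,
    Real.lt_log_iff_exp_lt (by positivity), lt_div_iff₀ hQ]
  calc Real.exp t * ∏ i, q (D i) < Real.exp t * (Real.exp (-t) * ∏ i, p (D i)) := by gcongr
    _ = ∏ i, p (D i) := by rw [← mul_assoc, ← Real.exp_add]; simp

theorem integrable_prod_regDensity {X Θ : Type*} [MeasurableSpace X] [MeasurableSpace Θ]
    {G : Θ → X → ℝ} (hG : Measurable fun p : Θ × X => G p.1 p.2) (ρ : Measure Θ)
    [IsFiniteMeasure ρ] {n : ℕ} (D : Fin n → ℝ × X) :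
    Integrable (fun θ => ∏ i, regDensity (G θ) (D i)) ρ := by
  have hm : Measurable fun θ => ∏ i, regDensity (G θ) (D i) :=
    Finset.measurable_fun_prod _ fun i _ =>
      measurable_regDensity_comp hG (u := fun θ => θ) (v := fun _ => D i) measurable_id
        measurable_const
  refine Integrable.of_bound hm.aestronglyMeasurable
    (∏ _i : Fin n, (Real.sqrt (2 * Real.pi))⁻¹) (ae_of_all _ fun θ => ?_)
  rw [Real.norm_of_nonneg (Finset.prod_nonneg fun i _ => (regDensity_pos _ _).le)]
  exact Finset.prod_le_prod (fun i _ => (regDensity_pos _ _).le) fun i _ => regDensity_le _ _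

theorem ofReal_integral_prod_regDensity {X Θ : Type*} [MeasurableSpace X] [MeasurableSpace Θ]
    {G : Θ → X → ℝ} (hG : Measurable fun p : Θ × X => G p.1 p.2) (ρ : Measure Θ)
    [IsFiniteMeasure ρ] {n : ℕ} (D : Fin n → ℝ × X) :
    ENNReal.ofReal (∫ θ, ∏ i, regDensity (G θ) (D i) ∂ρ) =
      ∫⁻ θ, ∏ i, ENNReal.ofReal (regDensity (G θ) (D i)) ∂ρ := by
  rw [ofReal_integral_eq_lintegral_ofReal (integrable_prod_regDensity hG ρ D)
    (ae_of_all _ fun θ => Finset.prod_nonneg fun i _ => (regDensity_pos _ _).le)]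
  simp_rw [ENNReal.ofReal_prod_of_nonneg fun i _ => (regDensity_pos _ _).le]

/-- Nonasymptotic bound on the expected posterior mass of `A`. -/
theorem enorm_integral_posterior_le {X Θ : Type*} [MeasurableSpace X] [MeasurableSpace Θ]
    (μ : Measure X) [IsProbabilityMeasure μ] {G : Θ → X → ℝ}
    (hG : Measurable fun p : Θ × X => G p.1 p.2) {B : ℝ} (hB : ∀ θ x, |G θ x| ≤ B)
    (θs : Θ) (prior : Measure Θ) [IsProbabilityMeasure prior] {s : ℝ} (hs : 0 < s)
    (A : Set Θ) (K : Set Θ)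
    (hK : K = {θ : Θ |
      (∫ x, (∫ y, regDensity (G θs) (y, x) *
          Real.log (regDensity (G θs) (y, x) / regDensity (G θ) (y, x))) ∂μ) ≤ s ∧
      (∫ x, (∫ y, regDensity (G θs) (y, x) *
          (Real.log (regDensity (G θs) (y, x) / regDensity (G θ) (y, x))) ^ 2) ∂μ) ≤ s})
    (hK0 : 0 < prior K) {n : ℕ} (hn : 0 < n) :
    ‖∫ D : Fin n → ℝ × X,
        ((∫ θ in A, ∏ i, regDensity (G θ) (D i) ∂prior) /
            (∫ θ, ∏ i, regDensity (G θ) (D i) ∂prior)) *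
          ∏ i, regDensity (G θs) (D i)
        ∂(Measure.pi fun _ : Fin n => (volume : Measure ℝ).prod μ)‖ₑ ≤
      2 * ENNReal.ofReal (1 / (n * s)) +
        prior A / (ENNReal.ofReal (Real.exp (-(2 * n * s))) * (prior K / 2)) := by
  have hGθ : ∀ θ, Measurable (G θ) := fun θ => hG.comp measurable_prodMk_left
  have hlog : Measurable fun p : Θ × (ℝ × X) =>
      Real.log (regDensity (G θs) p.2 / regDensity (G p.1) p.2) :=
    (((measurable_regDensity (hGθ θs)).comp measurable_snd).div
      (measurable_regDensity_comp hG measurable_fst measurable_snd)).log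
  have hKm : MeasurableSet K := by
    rw [hK]
    exact (measurableSet_le (measurable_integral_regDensity_mul μ (hGθ θs)
        (F := fun θ z => Real.log (regDensity (G θs) z / regDensity (G θ) z)) hlog)
      measurable_const).inter (measurableSet_le
      (measurable_integral_regDensity_mul μ (hGθ θs)
        (F := fun θ z => Real.log (regDensity (G θs) z / regDensity (G θ) z) ^ 2)
        (hlog.pow_const 2)) measurable_const)
  set ν := (volume : Measure ℝ).prod μ
  set N := Measure.pi fun _ : Fin n => ν
  set L : Θ → (Fin n → ℝ × X) → ENNReal :=
    fun θ D => ∏ i, ENNReal.ofReal (regDensity (G θ) (D i))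
  have hL : Measurable fun p : Θ × (Fin n → ℝ × X) => L p.1 p.2 :=
    Finset.measurable_fun_prod _ fun i _ => (measurable_regDensity_comp hG
      (u := fun p : Θ × (Fin n → ℝ × X) => p.1) (v := fun p => p.2 i) measurable_fst
      (by fun_prop)).ennreal_ofReal
  have hM : Measurable (L θs) := hL.of_uncurry_left (f := L)
  have hL1 : ∀ θ, ∫⁻ D, L θ D ∂N = 1 := fun θ => by
    refine (lintegral_pi_prod_eq_prod ν (fun _ z => ENNReal.ofReal (regDensity (G θ) z))
      fun _ => (measurable_regDensity (hGθ θ)).ennreal_ofReal).trans ?_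
    simp [ν, lintegral_regDensity_eq_one μ (hGθ θ)]
  set P := ν.withDensity fun z => ENNReal.ofReal (regDensity (G θs) z)
  have : IsProbabilityMeasure P :=
    ⟨by simpa [P] using lintegral_regDensity_eq_one μ (hGθ θs)⟩
  have hQ : (Measure.pi fun _ : Fin n => P) = N.withDensity (L θs) :=
    pi_withDensity_eq ν n _ (measurable_regDensity (hGθ θs)).ennreal_ofReal
  have hδ : ∀ θ ∈ K, N.withDensity (L θs)
      {D | L θ D < ENNReal.ofReal (Real.exp (-(2 * n * s))) * L θs D} ≤
        ENNReal.ofReal (1 / (n * s)) := by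
    intro θ hθ
    rw [hK] at hθ
    have hmem := memLp_two_log_regDensity_div μ (hGθ θs) (hGθ θ) (hB θs) (hB θ)
    rw [← hQ]
    refine (measure_mono fun D hD => ?_).trans (pi_sum_gt_le_of_moments P _ hmem hs ?_ ?_ hn)
    · exact lt_sum_log_of_ofReal_prod_lt (regDensity_pos _) (regDensity_pos _) hD
    · rw [integral_withDensity_regDensity μ (hGθ θs) (hmem.integrable one_le_two)]
      exact hθ.1
    · rw [integral_withDensity_regDensity μ (hGθ θs) hmem.integrable_sq]
      exact hθ.2
  have : SFinite (N.withDensity (L θs)) := hQ ▸ inferInstance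
  have hev := measure_evidence_lt_le prior (N.withDensity (L θs)) L hL (L θs) hM _ _ K hKm
    hK0.ne' hδ
  refine (enorm_integral_le_lintegral_enorm _).trans (le_trans (le_of_eq ?_)
    ((lintegral_posterior_mul_le prior N L hL hL1 (L θs) hM A _ ?_ ?_).trans
      (add_le_add_left hev _)))
  · refine lintegral_congr fun D => ?_
    have hden : 0 < ∫ θ, ∏ i, regDensity (G θ) (D i) ∂prior := by
      rw [integral_pos_iff_support_of_nonneg
        (fun θ => Finset.prod_nonneg fun i _ => (regDensity_pos _ _).le)
        (integrable_prod_regDensity hG prior D)]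
      have : Function.support (fun θ => ∏ i, regDensity (G θ) (D i)) = Set.univ :=
        Set.eq_univ_of_forall fun θ => (Finset.prod_pos fun i _ => regDensity_pos _ _).ne'
      simp [this]
    have hnum : 0 ≤ ∫ θ in A, ∏ i, regDensity (G θ) (D i) ∂prior :=
      integral_nonneg fun θ => Finset.prod_nonneg fun i _ => (regDensity_pos _ _).le
    have hp : 0 ≤ ∏ i, regDensity (G θs) (D i) :=
      Finset.prod_nonneg fun i _ => (regDensity_pos _ _).le
    have hquot := div_nonneg hnum hden.le
    rw [Real.enorm_eq_ofReal (mul_nonneg hquot hp), ENNReal.ofReal_mul hquot,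
      ENNReal.ofReal_div_of_pos hden, ofReal_integral_prod_regDensity hG,
      ofReal_integral_prod_regDensity hG,
      ENNReal.ofReal_prod_of_nonneg fun i _ => (regDensity_pos _ _).le]
  · exact mul_ne_zero (by simp [Real.exp_pos]) (ENNReal.half_pos hK0.ne').ne'
  · exact ENNReal.mul_ne_top ENNReal.ofReal_ne_top
      (ENNReal.div_ne_top (measure_ne_top _ _) (by simp))

/-- General criterion for posterior negligibility in the random-design Gaussian
regression model `Y = G(θ, X) + ε`, `X ∼ μ`, `ε ∼ N(0,1)`: if the sets `A n` have
exponentially small prior mass relative to the prior mass of the Kullback–Leibler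
neighbourhoods `KL n` of the truth `θs` (at scale `a n`, with `n (a n)² → ∞`), then the
`P_{θs}^n`-expected posterior mass of `A n` tends to zero. The expectation under
`P_{θs}^n` is written as the integral of the posterior mass times the product density
`∏ i, p_{θs}(D i)` against the `n`-fold product of the dominating measure `dy × dμ`. -/
theorem expected_posterior_mass_tendsto_zero
    {X Θ : Type*} [MeasurableSpace X] [MeasurableSpace Θ]
    (μ : Measure X) [IsProbabilityMeasure μ]
    (G : Θ → X → ℝ)
    (hGmeas : Measurable fun p : Θ × X => G p.1 p.2)
    (B : ℝ) (hGbdd : ∀ θ x, |G θ x| ≤ B)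
    (θs : Θ) (prior : Measure Θ) [IsProbabilityMeasure prior]
    (a : ℕ → ℝ) (hapos : ∀ n, 0 < a n)
    (hna : Tendsto (fun n : ℕ => (n : ℝ) * a n ^ 2) atTop atTop)
    (A : ℕ → Set Θ) (hAmeas : ∀ n, MeasurableSet (A n))
    (KL : ℕ → Set Θ)
    (hKL : ∀ n, KL n = {θ : Θ |
      (∫ x, (∫ y, regDensity (G θs) (y, x) *
          Real.log (regDensity (G θs) (y, x) / regDensity (G θ) (y, x))) ∂μ) ≤ a n ^ 2 ∧
      (∫ x, (∫ y, regDensity (G θs) (y, x) *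
          (Real.log (regDensity (G θs) (y, x) / regDensity (G θ) (y, x))) ^ 2) ∂μ)
        ≤ a n ^ 2})
    (hKLpos : ∀ n, 0 < prior (KL n))
    (hratio : Tendsto (fun n : ℕ =>
      Real.exp (2 * n * a n ^ 2) * (prior (A n)).toReal / (prior (KL n)).toReal)
      atTop (nhds 0)) :
    Tendsto (fun n : ℕ =>
      ∫ D : Fin n → ℝ × X,
        ((∫ θ in A n, ∏ i, regDensity (G θ) (D i) ∂prior) /
            (∫ θ, ∏ i, regDensity (G θ) (D i) ∂prior)) *
          ∏ i, regDensity (G θs) (D i)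
        ∂(Measure.pi fun _ : Fin n => (volume : Measure ℝ).prod μ))
      atTop (nhds 0) := by
  rw [tendsto_zero_iff_enorm_tendsto_zero]
  have hlim : Tendsto (fun n : ℕ => 2 * ENNReal.ofReal (1 / (n * a n ^ 2)) +
      ENNReal.ofReal (2 * (Real.exp (2 * n * a n ^ 2) * (prior (A n)).toReal /
        (prior (KL n)).toReal))) atTop (nhds 0) := by
    have h1 : Tendsto (fun n : ℕ => ENNReal.ofReal (1 / (n * a n ^ 2))) atTop (nhds 0) := by
      simpa using ENNReal.tendsto_ofReal (hna.inv_tendsto_atTop)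
    have h2 := ENNReal.tendsto_ofReal (hratio.const_mul 2)
    simpa using (ENNReal.Tendsto.const_mul h1 (Or.inr ENNReal.ofNat_ne_top)).add h2
  refine tendsto_of_tendsto_of_tendsto_of_le_of_le' tendsto_const_nhds hlim
    (Eventually.of_forall fun _ => zero_le) ?_
  filter_upwards [eventually_gt_atTop 0] with n hn
  refine (enorm_integral_posterior_le μ hGmeas hGbdd θs prior (sq_pos_of_pos (hapos n)) (A n)
    (KL n) (hKL n) (hKLpos n) hn).trans (le_of_eq ?_)
  congr 1
  have hKt : 0 < (prior (KL n)).toReal := ENNReal.toReal_pos (hKLpos n).ne' (measure_ne_top _ _)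
  have hA : prior (A n) = ENNReal.ofReal (prior (A n)).toReal :=
    (ENNReal.ofReal_toReal (measure_ne_top _ _)).symm
  have hK : prior (KL n) / 2 = ENNReal.ofReal ((prior (KL n)).toReal / 2) := by
    rw [ENNReal.ofReal_div_of_pos two_pos, ENNReal.ofReal_toReal (measure_ne_top _ _)]
    simp
  rw [hK, ← ENNReal.ofReal_mul (Real.exp_pos _).le]
  conv_lhs => rw [hA]
  rw [← ENNReal.ofReal_div_of_pos (by positivity), Real.exp_neg]
  congr 1
  field_simp
end
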